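/- arXiv:2002.12805 — 4 statements merged into one kernel-verified Lean document; each statement's English description precedes it below -/
import Mathlib

section
/- Let n, p be positive integers with p ≤ n, let W be a real n×p matrix of rank p, and let W = QR be a factorization with Q a real n×p matrix having orthonormal columns (QᵀQ = I_p) and R a real invertible p×p matrix. Then h(WWᵀ) = QQᵀ, i.e., the matrix heaviside function applied to WWᵀ equals the orthogonal projection onto the column space of W. -/
open Matrix

/-- The scalar heaviside function: `h t = 1` if `t > 0` and `h t = 0` if `t ≤ 0`. -/
noncomputable def heaviside : ℝ → ℝ := fun t => if 0 < t then 1 else 0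

namespace Matrix.IsHermitian

variable {n 𝕜 : Type*} [RCLike 𝕜] [Fintype n] [DecidableEq n] {A : Matrix n n 𝕜}

theorem cfc_mul_self (hA : A.IsHermitian) (f : ℝ → ℝ) :
    hA.cfc f * A = hA.cfc fun t => f t * t := by
  refine (congrArg (hA.cfc f * ·) hA.spectral_theorem).trans ?_
  simp only [IsHermitian.cfc, ← map_mul, diagonal_mul_diagonal]
  congr 2
  ext i
  simp

theorem cfc_congr_eigenvalues (hA : A.IsHermitian) {f g : ℝ → ℝ}
    (h : ∀ i, f (hA.eigenvalues i) = g (hA.eigenvalues i)) : hA.cfc f = hA.cfc g := by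
  have hfg : f ∘ hA.eigenvalues = g ∘ hA.eigenvalues := funext h
  rw [IsHermitian.cfc, IsHermitian.cfc, hfg]

theorem cfc_id_eq_self (hA : A.IsHermitian) : (hA.cfc fun t => t) = A :=
  hA.spectral_theorem.symm

end Matrix.IsHermitian

theorem heaviside_mul_self {t : ℝ} (ht : 0 ≤ t) : heaviside t * t = t := by
  rcases ht.eq_or_lt with rfl | h
  · simp
  · simp [heaviside, h]

theorem inv_mul_self_eq_heaviside {t : ℝ} (ht : 0 ≤ t) : t⁻¹ * t = heaviside t := by
  rcases ht.eq_or_lt with rfl | h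
  · simp [heaviside]
  · simp [heaviside, h, h.ne']

/-- If `W` is a real `n × p` matrix of rank `p` (with `p ≤ n`), and `W = Q * R` with
`Qᵀ * Q = I` and `R` invertible, then the matrix heaviside function applied to `W * Wᵀ`
equals the orthogonal projection `Q * Qᵀ`. -/
theorem heaviside_mul_transpose_eq_proj {n p : ℕ} (hn : 0 < n) (hp : 0 < p) (hpn : p ≤ n)
    (W Q : Matrix (Fin n) (Fin p) ℝ) (R : Matrix (Fin p) (Fin p) ℝ)
    (hrank : W.rank = p)
    (hQR : W = Q * R)
    (hQ : Qᵀ * Q = 1)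
    (hR : IsUnit R)
    (hH : (W * Wᵀ).IsHermitian) :
    hH.cfc heaviside = Q * Qᵀ := by
  have hpos : ∀ i, 0 ≤ hH.eigenvalues i := by
    have h := posSemidef_self_mul_conjTranspose W
    rw [conjTranspose_eq_transpose_of_trivial] at h
    exact h.eigenvalues_nonneg
  have hA : W * Wᵀ = Q * (R * Rᵀ) * Qᵀ := by
    rw [hQR, transpose_mul]
    simp only [Matrix.mul_assoc]
  have hAQ : W * Wᵀ * Q = Q * (R * Rᵀ) := by
    rw [hA, Matrix.mul_assoc, hQ, Matrix.mul_one]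
  have hAP : W * Wᵀ * (Q * Qᵀ) = W * Wᵀ := by
    rw [← Matrix.mul_assoc, hAQ, hA]
  have hcA : hH.cfc heaviside * (W * Wᵀ) = W * Wᵀ :=
    (hH.cfc_mul_self heaviside).trans <|
      (hH.cfc_congr_eigenvalues fun i => heaviside_mul_self (hpos i)).trans hH.cfc_id_eq_self
  have hinv : (hH.cfc fun t => t⁻¹) * (W * Wᵀ) = hH.cfc heaviside :=
    (hH.cfc_mul_self _).trans <|
      hH.cfc_congr_eigenvalues fun i => inv_mul_self_eq_heaviside (hpos i)
  have hRR : IsUnit (R * Rᵀ).det := by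
    have h := (isUnit_iff_isUnit_det R).mp hR
    rw [det_mul, det_transpose]
    exact h.mul h
  have hcQ : hH.cfc heaviside * Q = Q := by
    have h : hH.cfc heaviside * Q * (R * Rᵀ) = Q * (R * Rᵀ) := by
      rw [Matrix.mul_assoc, ← hAQ, ← Matrix.mul_assoc, hcA]
    rw [← mul_nonsing_inv_cancel_right (R * Rᵀ) (hH.cfc heaviside * Q) hRR, h,
      mul_nonsing_inv_cancel_right _ _ hRR]
  calc hH.cfc heaviside = hH.cfc heaviside * (Q * Qᵀ) := by
        rw [← hinv, Matrix.mul_assoc, hAP]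
    _ = Q * Qᵀ := by rw [← Matrix.mul_assoc, hcQ]
end

section
/- Let n, p be positive integers with p ≤ n. Suppose A : ℝ^{n×p} → ℝ^{n×n} and B : ℝ^{n×n} → ℝ^{n×n} satisfy the basis invariance conditions: A(W) = B(WWᵀ) for every real n×p matrix W, and B(X) = B(h(X)) for every real symmetric n×n matrix X. Then A(W) = A(WP) for every real n×p matrix W of rank p and every invertible real p×p matrix P. -/
open Matrix

theorem Matrix.IsHermitian.cfc_mul_cfc {n : Type*} [Fintype n] [DecidableEq n]
    {X : Matrix n n ℝ} (hX : X.IsHermitian) (f g : ℝ → ℝ) :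
    hX.cfc f * hX.cfc g = hX.cfc (f * g) := by
  simp only [Matrix.IsHermitian.cfc, ← map_mul, diagonal_mul_diagonal]
  rfl

theorem Matrix.IsHermitian.cfc_id {n : Type*} [Fintype n] [DecidableEq n]
    {X : Matrix n n ℝ} (hX : X.IsHermitian) : hX.cfc id = X :=
  hX.spectral_theorem.symm

theorem Matrix.IsHermitian.cfc_congr {n : Type*} [Fintype n] [DecidableEq n]
    {X : Matrix n n ℝ} (hX : X.IsHermitian) {f g : ℝ → ℝ}
    (h : ∀ i, f (hX.eigenvalues i) = g (hX.eigenvalues i)) : hX.cfc f = hX.cfc g := by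
  have : f ∘ hX.eigenvalues = g ∘ hX.eigenvalues := funext h
  simp only [Matrix.IsHermitian.cfc, this]

theorem Matrix.IsHermitian.transpose_cfc {n : Type*} [Fintype n] [DecidableEq n]
    {X : Matrix n n ℝ} (hX : X.IsHermitian) (f : ℝ → ℝ) : (hX.cfc f)ᵀ = hX.cfc f := by
  rw [← conjTranspose_eq_transpose_of_trivial, ← star_eq_conjTranspose, Matrix.IsHermitian.cfc,
    ← map_star, star_eq_conjTranspose, diagonal_conjTranspose, star_trivial]

/-- The heaviside of a Gram matrix `W * Wᵀ` fixes `W`. -/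
theorem heaviside_cfc_mul_self {n m : Type*} [Fintype n] [DecidableEq n] [Fintype m]
    (W : Matrix n m ℝ) (hX : (W * Wᵀ).IsHermitian) : hX.cfc heaviside * W = W := by
  have hpos : (W * Wᵀ).PosSemidef := by
    simpa using posSemidef_self_mul_conjTranspose W
  have hfix : hX.cfc heaviside * (W * Wᵀ) = W * Wᵀ := by
    have h : hX.cfc heaviside * hX.cfc id = hX.cfc id := by
      rw [hX.cfc_mul_cfc]
      refine hX.cfc_congr fun i => ?_
      have := hpos.eigenvalues_nonneg i
      rcases this.eq_or_lt with h | h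
      · simp [← h]
      · simp [heaviside, h]
    simpa only [hX.cfc_id] using h
  have hzero : (hX.cfc heaviside - 1) * W = 0 := by
    rw [← mul_self_mul_conjTranspose_eq_zero, conjTranspose_eq_transpose_of_trivial,
      Matrix.sub_mul, hfix, Matrix.one_mul, sub_self]
  rwa [Matrix.sub_mul, Matrix.one_mul, sub_eq_zero] at hzero

/-- The columns of the heaviside of a Gram matrix `W * Wᵀ` are combinations of those of `W`. -/
theorem exists_heaviside_cfc_eq_mul {n m : Type*} [Fintype n] [DecidableEq n] [Fintype m]
    (W : Matrix n m ℝ) (hX : (W * Wᵀ).IsHermitian) :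
    ∃ Z : Matrix m n ℝ, hX.cfc heaviside = W * Z := by
  let g : ℝ → ℝ := fun t => if 0 < t then t⁻¹ else 0
  refine ⟨Wᵀ * hX.cfc g, ?_⟩
  have h : hX.cfc heaviside = hX.cfc id * hX.cfc g := by
    rw [hX.cfc_mul_cfc]
    refine hX.cfc_congr fun i => ?_
    by_cases h : 0 < hX.eigenvalues i
    · simp [heaviside, g, h, h.ne']
    · simp [heaviside, g, h]
  rwa [hX.cfc_id, Matrix.mul_assoc] at h

/-- Matrices whose columns generate each other have Gram matrices with the same heaviside. -/
theorem heaviside_cfc_eq_of_eq_mul {n m k : Type*} [Fintype n] [DecidableEq n] [Fintype m]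
    [Fintype k] {W : Matrix n m ℝ} {V : Matrix n k ℝ} {P : Matrix m k ℝ} {Q : Matrix k m ℝ}
    (hV : V = W * P) (hW : W = V * Q) (hX : (W * Wᵀ).IsHermitian) (hY : (V * Vᵀ).IsHermitian) :
    hX.cfc heaviside = hY.cfc heaviside := by
  have hXV : hX.cfc heaviside * V = V := by
    rw [hV, ← Matrix.mul_assoc, heaviside_cfc_mul_self]
  have hYW : hY.cfc heaviside * W = W := by
    conv_lhs => rw [hW]
    rw [← Matrix.mul_assoc, heaviside_cfc_mul_self, ← hW]
  have hXY : hX.cfc heaviside * hY.cfc heaviside = hY.cfc heaviside := by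
    obtain ⟨Z, hZ⟩ := exists_heaviside_cfc_eq_mul V hY
    rw [hZ, ← Matrix.mul_assoc, hXV]
  have hYX : hY.cfc heaviside * hX.cfc heaviside = hX.cfc heaviside := by
    obtain ⟨Z, hZ⟩ := exists_heaviside_cfc_eq_mul W hX
    rw [hZ, ← Matrix.mul_assoc, hYW]
  have h := congrArg transpose hYX
  rw [transpose_mul, hX.transpose_cfc, hY.transpose_cfc, hXY] at h
  exact h.symm

/-- Basis invariance: if `A W = B (W * Wᵀ)` for all `W`, and `B X = B (h X)` for all
symmetric `X` (with `h` the matrix heaviside function), then `A W = A (W * P)` for every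
full-column-rank `W` and every invertible `P`. -/
theorem basis_invariance {n p : ℕ} (hn : 0 < n) (hp : 0 < p) (hpn : p ≤ n)
    (A : Matrix (Fin n) (Fin p) ℝ → Matrix (Fin n) (Fin n) ℝ)
    (B : Matrix (Fin n) (Fin n) ℝ → Matrix (Fin n) (Fin n) ℝ)
    (hAB : ∀ W : Matrix (Fin n) (Fin p) ℝ, A W = B (W * Wᵀ))
    (hBh : ∀ (X : Matrix (Fin n) (Fin n) ℝ) (hX : X.IsHermitian), B X = B (hX.cfc heaviside))
    (W : Matrix (Fin n) (Fin p) ℝ) (hrank : W.rank = p)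
    (P : Matrix (Fin p) (Fin p) ℝ) (hP : IsUnit P) :
    A W = A (W * P) := by
  have hherm (V : Matrix (Fin n) (Fin p) ℝ) : (V * Vᵀ).IsHermitian := by
    simpa using isHermitian_mul_conjTranspose_self V
  obtain ⟨Q, hPQ⟩ := hP.exists_right_inv
  rw [hAB, hAB, hBh _ (hherm W), hBh _ (hherm (W * P)),
    heaviside_cfc_eq_of_eq_mul (Q := Q) rfl (by rw [Matrix.mul_assoc, hPQ, Matrix.mul_one])]
end

section
/- (Eigenproblem equivalence, devectorized form of Theorem 3.) Let A : ℝ^{n×p} → ℝ^{n×n} be Fréchet differentiable at V ∈ ℝ^{n×p}, and suppose A((1+t)V) = A(V) for all t in some neighborhood of 0. Define F : ℝ^{n×p} → ℝ^{n×p} by F(W) = A(W)·W. Then F is Fréchet differentiable at V and the Fréchet derivative of F at V applied to the direction V equals A(V)·V, i.e., (DF(V))[V] = A(V)V. Equivalently, in vectorized form, the Jacobian J of v ↦ (I_p ⊗ A(V))v satisfies J(v)v = (I_p ⊗ A(V))v. -/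
open Matrix

attribute [local instance] Matrix.normedAddCommGroup Matrix.normedSpace

/-- A bilinear map on finite-dimensional spaces, applied to two differentiable maps, is
differentiable. -/
theorem DifferentiableAt.linearMap_apply₂ {E X Y Z : Type*}
    [NormedAddCommGroup E] [NormedSpace ℝ E]
    [NormedAddCommGroup X] [NormedSpace ℝ X] [FiniteDimensional ℝ X]
    [NormedAddCommGroup Y] [NormedSpace ℝ Y] [FiniteDimensional ℝ Y]
    [NormedAddCommGroup Z] [NormedSpace ℝ Z]
    (B : X →ₗ[ℝ] Y →ₗ[ℝ] Z) {f : E → X} {g : E → Y} {x : E}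
    (hf : DifferentiableAt ℝ f x) (hg : DifferentiableAt ℝ g x) :
    DifferentiableAt ℝ (fun y => B (f y) (g y)) x :=
  (B.toContinuousBilinearMap.differentiableAt.comp x hf).clm_apply hg

/-- The product of two differentiable matrix-valued maps is differentiable. -/
theorem DifferentiableAt.matrix_mul {E : Type*} [NormedAddCommGroup E] [NormedSpace ℝ E]
    {l m n : Type*} [Fintype l] [Fintype m] [Fintype n]
    {f : E → Matrix l m ℝ} {g : E → Matrix m n ℝ} {x : E}
    (hf : DifferentiableAt ℝ f x) (hg : DifferentiableAt ℝ g x) :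
    DifferentiableAt ℝ (fun y => f y * g y) x :=
  hf.linearMap_apply₂ (mulLinearMap ℝ) hg

/-- If `F` sends `(1 + t) • v` to `(1 + t) • w` for all small `t`, then its
derivative at `v` in the direction `v` is `w`. -/
theorem fderiv_apply_self_of_eventually_smul {E G : Type*}
    [NormedAddCommGroup E] [NormedSpace ℝ E] [NormedAddCommGroup G] [NormedSpace ℝ G]
    {F : E → G} {v : E} {w : G} (hF : DifferentiableAt ℝ F v)
    (h : ∀ᶠ t : ℝ in nhds 0, F ((1 + t) • v) = (1 + t) • w) :
    fderiv ℝ F v v = w := by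
  have hv : HasDerivAt (fun t : ℝ => (1 + t) • v) v 0 := by
    simpa using ((hasDerivAt_id (0 : ℝ)).const_add 1).smul_const v
  have hF' : HasFDerivAt F (fderiv ℝ F v) ((1 + (0 : ℝ)) • v) := by
    simpa using hF.hasFDerivAt
  have hw : HasDerivAt (fun t : ℝ => (1 + t) • w) w 0 := by
    simpa using ((hasDerivAt_id (0 : ℝ)).const_add 1).smul_const w
  exact (hF'.comp_hasDerivAt 0 hv).unique (hw.congr_of_eventuallyEq h)

/-- Eigenproblem equivalence (Theorem 3), devectorized: if `A` is Fréchet differentiable at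
`V` and `A ((1 + t) • V) = A V` for `t` near `0`, then `F W := A W * W` is Fréchet
differentiable at `V` and its derivative at `V` in the direction `V` equals `A V * V`. -/
theorem fderiv_nepv_map_along_ray {n p : ℕ}
    (A : Matrix (Fin n) (Fin p) ℝ → Matrix (Fin n) (Fin n) ℝ)
    (V : Matrix (Fin n) (Fin p) ℝ)
    (hdiff : DifferentiableAt ℝ A V)
    (hscale : ∀ᶠ t : ℝ in nhds 0, A ((1 + t) • V) = A V) :
    DifferentiableAt ℝ (fun W => A W * W) V ∧
      fderiv ℝ (fun W => A W * W) V V = A V * V := by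
  have hF : DifferentiableAt ℝ (fun W => A W * W) V := hdiff.matrix_mul differentiableAt_id
  refine ⟨hF, fderiv_apply_self_of_eventually_smul hF ?_⟩
  filter_upwards [hscale] with t ht
  rw [ht, Matrix.mul_smul]
end

section
/- (Lemma 4(a), devectorized.) Let V and W be real n×p matrices. If (1/2)·((W − V)ᵀV + Vᵀ(W − V) + (W − V)ᵀW + Wᵀ(W − V)) = I_p − VᵀV, then WᵀW = I_p. That is, the modified Newton update with the averaged constraint Jacobian Z_k produces orthonormal iterates. -/
open Matrix

/-- Devectorized form of Lemma 4(a): if the averaged-constraint Newton update equation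
`(1/2) ((W - V)ᵀ V + Vᵀ (W - V) + (W - V)ᵀ W + Wᵀ (W - V)) = I - Vᵀ V` holds, then the new
iterate is orthonormal, `Wᵀ W = I`. -/
theorem averaged_constraint_orthonormal {n p : ℕ}
    (V W : Matrix (Fin n) (Fin p) ℝ)
    (h : (1 / 2 : ℝ) • ((W - V)ᵀ * V + Vᵀ * (W - V) + (W - V)ᵀ * W + Wᵀ * (W - V))
        = 1 - Vᵀ * V) :
    Wᵀ * W = 1 := by
  have key : (1 / 2 : ℝ) • ((W - V)ᵀ * V + Vᵀ * (W - V) + (W - V)ᵀ * W + Wᵀ * (W - V))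
      = Wᵀ * W - Vᵀ * V := by
    simp only [transpose_sub, Matrix.sub_mul, Matrix.mul_sub]
    module
  exact sub_left_injective (key.symm.trans h)
end
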